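/- For the choice c₁(x) = c₂(x) = 1, d(x) = −e (the negative of Euler's number), g₁(x) = g₂(x) = 1 and α = 0, the system −V'(x) + c₁(x) V(x) = g₁(x), −W'(x) + c₂(x) W(x) + d(x) V(x) = g₂(x) for x ∈ (0,1) with W(1) = 0 and V(1) = W(0) has no solution pair (V, W) of C¹ functions on [0,1]. -/

import Mathlib

open Set

/-- For `c₁ = c₂ = 1`, `d = −e`, `g₁ = g₂ = 1` and `α = 0`, the system
`−V' + V = 1`, `−W' + W − e·V = 1` on `(0,1)` with `W(1) = 0` and `V(1) = W(0)`
has no solution pair of `C¹` functions on `[0,1]`. -/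
theorem ode_system_no_solution :
    ¬ ∃ V W : ℝ → ℝ,
      ContDiffOn ℝ 1 V (Icc 0 1) ∧ ContDiffOn ℝ 1 W (Icc 0 1) ∧
      (∀ x ∈ Ioo (0:ℝ) 1, -deriv V x + V x = 1) ∧
      (∀ x ∈ Ioo (0:ℝ) 1, -deriv W x + W x + (-Real.exp 1) * V x = 1) ∧
      W 1 = 0 ∧ V 1 = W 0 := by
  rintro ⟨V, W, hV, hW, hV', hW', hW1, hVW⟩
  have hasDerivAt_of_contDiffOn {f : ℝ → ℝ} (hf : ContDiffOn ℝ 1 f (Icc 0 1)) :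
      ∀ x ∈ Ioo (0:ℝ) 1, HasDerivAt f (deriv f x) x := fun x hx =>
    ((hf.differentiableOn one_ne_zero).differentiableAt
      (Icc_mem_nhds hx.1 hx.2)).hasDerivAt
  -- A first integral of the system.
  let F : ℝ → ℝ := fun x =>
    ((W x - (Real.exp 1 + 1)) + Real.exp 1 * ((V x - 1) * x)) * Real.exp (-x)
  have hF : ContinuousOn F (Icc 0 1) := by
    have hVc := hV.continuousOn
    have hWc := hW.continuousOn
    fun_prop
  have hF' : ∀ x ∈ Ioo (0:ℝ) 1, HasDerivAt F 0 x := by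
    intro x hx
    have h := (((hasDerivAt_of_contDiffOn hW x hx).sub_const (Real.exp 1 + 1)).add
      ((((hasDerivAt_of_contDiffOn hV x hx).sub_const 1).mul (hasDerivAt_id x)).const_mul
        (Real.exp 1))).mul (hasDerivAt_neg x).exp
    refine h.congr_deriv ?_
    have hdV : deriv V x = V x - 1 := by linarith [hV' x hx]
    have hdW : deriv W x = W x - Real.exp 1 * V x - 1 := by linarith [hW' x hx]
    simp only [Pi.add_apply, Pi.mul_apply, id_eq, hdV, hdW]
    ring
  obtain ⟨_, -, hslope⟩ :=
    exists_hasDerivAt_eq_slope F (fun _ => 0) zero_lt_one hF hF'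
  have hend : F 1 = F 0 := by linarith
  simp only [F, hW1, hVW, Real.exp_neg, Real.exp_zero] at hend
  field_simp at hend
  nlinarith [Real.exp_one_gt_d9]
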